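/- Let a ≠ 0 be real and let λ = 4a²/π² > 0. For every θ ∈ [0,π] there exists a continuous potential V on [0,∞) with limsup_{x→∞} x·|V(x)| = |a| such that the Schrödinger equation -u'' + V·u = λ·u has a solution u, not identically zero, which is twice continuously differentiable on [0,∞), satisfies the equation on (0,∞), has ∫₀^∞ u(x)² dx < ∞, and satisfies the boundary condition u'(0)·cos θ = u(0)·sin θ. -/

import Mathlib

open Filter MeasureTheory Set Real

namespace Crit

noncomputable section

def hh (t : ℝ) : ℝ := 1 / t + 2 / (t * Real.log t)

def tau (t : ℝ) : ℝ := max t 10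

def SS (t : ℝ) : ℝ := Real.sin (2 * t) / (|Real.sin (2 * t)| + 1 / tau t)

def ff (t : ℝ) : ℝ := -(π / 2) * hh (tau t) * SS t

def PP (t : ℝ) : ℝ := ∫ s in (0 : ℝ)..t, (1 / 2 - π / 4 * |Real.sin (2 * s)|)

def DD (t : ℝ) : ℝ := 1 / (1 - ff t * Real.sin t ^ 2)

def XX (t₀ t : ℝ) : ℝ := ∫ s in t₀..t, DD s

def LL (t₀ t : ℝ) : ℝ := ∫ s in t₀..t, ff s * Real.sin s * Real.cos s * DD s

lemma tau_ge (t : ℝ) : 10 ≤ tau t := le_max_right _ _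
lemma tau_eq {t : ℝ} (h : 10 ≤ t) : tau t = t := max_eq_left h
lemma tau_cont : Continuous tau := by unfold tau; fun_prop

lemma log_ge {t : ℝ} (h : 10 ≤ t) : 1 ≤ Real.log t := by
  rw [Real.le_log_iff_exp_le (by linarith)]
  have := Real.exp_one_lt_d9
  linarith

lemma hh_pos {t : ℝ} (h : 10 ≤ t) : 0 < hh t := by
  have := log_ge h
  unfold hh
  positivity

lemma hh_le {t : ℝ} (h : 10 ≤ t) : hh t ≤ 3 / t := by
  have hl := log_ge h
  have : 2 / (t * Real.log t) ≤ 2 / t := by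
    apply div_le_div_of_nonneg_left (by norm_num) (by linarith)
    nlinarith
  have h3 : (3 : ℝ) / t = 1 / t + 2 / t := by ring
  unfold hh
  linarith

lemma hh_hasDeriv {t : ℝ} (h : 10 ≤ t) :
    HasDerivAt hh (-1 / t ^ 2 - 2 * (Real.log t + 1) / (t * Real.log t) ^ 2) t := by
  have hl := log_ge h
  have ht : t ≠ 0 := by linarith
  have hlt : Real.log t ≠ 0 := by linarith
  have h1 := (hasDerivAt_id t).inv ht
  have h2 := (((hasDerivAt_id t).mul (Real.hasDerivAt_log ht)).inv (mul_ne_zero ht hlt)).const_mul 2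
  have h3 := h1.add h2
  have e : hh = (fun t => (id t)⁻¹ + 2 * (id t * Real.log t)⁻¹) := by
    funext t; simp [hh, div_eq_mul_inv]
  rw [e]
  refine HasDerivAt.congr_deriv (f := fun t => (id t)⁻¹ + 2 * (id t * Real.log t)⁻¹) h3 ?_
  simp only [id, Pi.mul_apply]
  field_simp
  ring

lemma hh_deriv_bd {t : ℝ} (h : 10 ≤ t) :
    |(-1 / t ^ 2 - 2 * (Real.log t + 1) / (t * Real.log t) ^ 2)| ≤ 5 / t ^ 2 := by
  have hl := log_ge h
  have ht : 0 < t := by linarith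
  have e : (-1 / t ^ 2 - 2 * (Real.log t + 1) / (t * Real.log t) ^ 2)
    = -((1 + 2 * (Real.log t + 1) / (Real.log t) ^ 2) / t ^ 2) := by
    field_simp
    ring
  rw [e, abs_neg, abs_of_nonneg (by positivity)]
  have : 2 * (Real.log t + 1) / (Real.log t) ^ 2 ≤ 4 := by
    rw [div_le_iff₀ (by positivity)]; nlinarith
  gcongr
  linarith

lemma hh_tau_cont : Continuous (fun t => hh (tau t)) := by
  have : ∀ t, HasDerivAt hh _ (tau t) := fun t => hh_hasDeriv (tau_ge t)
  rw [continuous_iff_continuousAt]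
  intro t
  exact (this t).continuousAt.comp (f := tau) tau_cont.continuousAt

lemma SS_cont : Continuous SS := by
  unfold SS
  have h1 : ∀ t, tau t ≠ 0 := fun t => by linarith [tau_ge t]
  have h2 : ∀ t, |Real.sin (2 * t)| + 1 / tau t ≠ 0 := fun t => by
    have := tau_ge t
    positivity
  exact Continuous.div (by fun_prop) (Continuous.add (by fun_prop)
    (continuous_const.div tau_cont h1)) h2

lemma ff_cont : Continuous ff := by
  unfold ff
  exact (continuous_const.mul hh_tau_cont).mul SS_cont

lemma SS_abs (t : ℝ) : |SS t| ≤ 1 := by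
  have := tau_ge t
  unfold SS
  rw [abs_div, abs_of_nonneg (a := |Real.sin (2 * t)| + 1 / tau t) (by positivity)]
  rw [div_le_one (by positivity)]
  have : 0 < 1 / tau t := by positivity
  linarith

lemma SS_mul (t : ℝ) : |Real.sin (2 * t)| - 1 / tau t ≤ Real.sin (2 * t) * SS t := by
  have := tau_ge t
  have hp : 0 < 1 / tau t := by positivity
  unfold SS
  have h0 := abs_nonneg (Real.sin (2 * t))
  have hs := abs_mul_abs_self (Real.sin (2 * t))
  rw [← mul_div_assoc, le_div_iff₀ (by positivity)]
  nlinarith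

lemma ff_abs_le (t : ℝ) : |ff t| ≤ π / 2 * hh (tau t) := by
  have h1 := SS_abs t
  have h2 := hh_pos (tau_ge t)
  unfold ff
  rw [abs_mul, abs_mul, abs_neg, abs_of_pos (by positivity : 0 < π / 2), abs_of_pos h2]
  have : 0 < π / 2 * hh (tau t) := by positivity
  nlinarith

lemma ff_abs_half (t : ℝ) : |ff t| ≤ 1 / 2 := by
  have h1 := ff_abs_le t
  have h2 := hh_le (tau_ge t)
  have h3 : (3 : ℝ) / tau t ≤ 3 / 10 := by gcongr; exact tau_ge t
  have h4 := Real.pi_lt_d2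
  have h5 := Real.pi_gt_three
  have h6 := hh_pos (tau_ge t)
  nlinarith

lemma ff_abs_t {t : ℝ} (h : 10 ≤ t) : |ff t| ≤ 5 / t := by
  have h1 := ff_abs_le t
  rw [tau_eq h] at h1
  have h2 := hh_le h
  have h4 := Real.pi_lt_d2
  have h5 := Real.pi_gt_three
  have h6 := hh_pos h
  have : (5 : ℝ) / t = 5 / 3 * (3 / t) := by ring
  rw [this]
  nlinarith

lemma den_bd (t : ℝ) : 1 / 2 ≤ 1 - ff t * Real.sin t ^ 2 ∧ 1 - ff t * Real.sin t ^ 2 ≤ 3 / 2 := by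
  have h1 := abs_le.1 (ff_abs_half t)
  have h2 := Real.sin_sq_le_one t
  have h3 := sq_nonneg (Real.sin t)
  constructor <;> nlinarith

lemma DD_cont : Continuous DD := by
  unfold DD
  refine continuous_const.div (by have := ff_cont; fun_prop) (fun t => ?_)
  linarith [(den_bd t).1]

lemma DD_pos (t : ℝ) : 1 / 2 ≤ DD t := by
  have := den_bd t
  unfold DD
  rw [le_div_iff₀ (by linarith)]
  linarith

lemma DD_sub (t : ℝ) : |DD t - 1| ≤ 2 * |ff t| := by
  have := den_bd t
  have e : DD t - 1 = ff t * Real.sin t ^ 2 / (1 - ff t * Real.sin t ^ 2) := by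
    unfold DD
    have : (1 - ff t * Real.sin t ^ 2) ≠ 0 := by linarith
    field_simp
    ring
  have h2 := Real.sin_sq_le_one t
  rw [e, abs_div, abs_of_pos (a := 1 - ff t * Real.sin t ^ 2) (by linarith), div_le_iff₀ (by linarith),
    abs_mul, abs_of_nonneg (sq_nonneg (Real.sin t))]
  have := abs_nonneg (ff t)
  nlinarith

lemma DD_sub_t {t : ℝ} (h : 10 ≤ t) : |DD t - 1| ≤ 10 / t := by
  have h1 := DD_sub t
  have h2 := ff_abs_t h
  have : (10 : ℝ) / t = 2 * (5 / t) := by ring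
  linarith

lemma XX_hasDeriv (t₀ t : ℝ) : HasDerivAt (XX t₀) (DD t) t :=
  intervalIntegral.integral_hasDerivAt_right (DD_cont.intervalIntegrable _ _)
    (DD_cont.stronglyMeasurableAtFilter _ _) DD_cont.continuousAt

lemma LLi_cont : Continuous (fun s => ff s * Real.sin s * Real.cos s * DD s) := by
  have := ff_cont
  have := DD_cont
  fun_prop

lemma LL_hasDeriv (t₀ t : ℝ) : HasDerivAt (LL t₀) (ff t * Real.sin t * Real.cos t * DD t) t :=
  intervalIntegral.integral_hasDerivAt_right (LLi_cont.intervalIntegrable _ _)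
    (LLi_cont.stronglyMeasurableAtFilter _ _) LLi_cont.continuousAt

lemma PPi_cont : Continuous (fun s : ℝ => (1 / 2 - π / 4 * |Real.sin (2 * s)|)) := by
  fun_prop

lemma PP_hasDeriv (t : ℝ) : HasDerivAt PP (1 / 2 - π / 4 * |Real.sin (2 * t)|) t :=
  intervalIntegral.integral_hasDerivAt_right (PPi_cont.intervalIntegrable _ _)
    (PPi_cont.stronglyMeasurableAtFilter _ _) PPi_cont.continuousAt

lemma int_abs_sin : ∫ s in (0 : ℝ)..(π / 2), |Real.sin (2 * s)| = 1 := by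
  have : ∫ s in (0 : ℝ)..(π / 2), |Real.sin (2 * s)| = ∫ s in (0 : ℝ)..(π / 2), Real.sin (2 * s) := by
    apply intervalIntegral.integral_congr
    intro s hs
    rw [uIcc_of_le (by positivity)] at hs
    exact abs_of_nonneg (Real.sin_nonneg_of_nonneg_of_le_pi (by linarith [hs.1]) (by linarith [hs.2]))
  rw [this, intervalIntegral.integral_comp_mul_left (fun s => Real.sin s) (by norm_num)]
  rw [integral_sin, mul_div_cancel₀ _ (by norm_num : (2:ℝ) ≠ 0)]
  norm_num

lemma PPi_per : Function.Periodic (fun s : ℝ => (1 / 2 - π / 4 * |Real.sin (2 * s)|)) (π / 2) := by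
  intro s
  simp only
  rw [show 2 * (s + π / 2) = 2 * s + π by ring, Real.sin_add_pi, abs_neg]

lemma PP_per : Function.Periodic PP (π / 2) := by
  intro t
  unfold PP
  rw [← intervalIntegral.integral_add_adjacent_intervals (b := t)
    (PPi_cont.intervalIntegrable _ _) (PPi_cont.intervalIntegrable _ _)]
  rw [PPi_per.intervalIntegral_add_eq t 0, zero_add]
  have : ∫ s in (0 : ℝ)..(π / 2), (1 / 2 - π / 4 * |Real.sin (2 * s)|) = 0 := by
    rw [intervalIntegral.integral_sub (by simp) (by apply Continuous.intervalIntegrable; fun_prop)]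
    rw [intervalIntegral.integral_const_mul, int_abs_sin]
    simp
    ring
  rw [this, add_zero]

lemma PP_bdd : ∃ M : ℝ, 0 ≤ M ∧ ∀ t, |PP t| ≤ M := by
  have hc : Continuous PP := continuous_iff_continuousAt.2 fun t => (PP_hasDeriv t).continuousAt
  obtain ⟨M, hM⟩ := (PP_per.isBounded_of_continuous (by positivity) hc).exists_norm_le
  refine ⟨M, le_trans (norm_nonneg _) (hM (PP 0) ⟨0, rfl⟩), fun t => hM _ ⟨t, rfl⟩⟩

lemma anti_of {g g' : ℝ → ℝ} (h : ∀ t, 10 ≤ t → HasDerivAt g (g' t) t)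
    (h' : ∀ t, 10 ≤ t → g' t ≤ 0) {t : ℝ} (ht : 10 ≤ t) : g t ≤ g 10 := by
  have : AntitoneOn g (Ici 10) := by
    apply antitoneOn_of_deriv_nonpos (convex_Ici _)
    · exact fun x hx => (h x hx).continuousAt.continuousWithinAt
    · intro x hx
      rw [interior_Ici] at hx
      exact (h x (le_of_lt hx)).differentiableAt.differentiableWithinAt
    · intro x hx
      rw [interior_Ici] at hx
      rw [(h x (le_of_lt hx)).deriv]
      exact h' x (le_of_lt hx)
  exact this (mem_Ici.2 le_rfl) ht ht

lemma XX_up (t₀ : ℝ) {t : ℝ} (ht : 10 ≤ t) :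
    XX t₀ t - t - 10 * Real.log t ≤ XX t₀ 10 - 10 - 10 * Real.log 10 := by
  refine anti_of (g := fun t => XX t₀ t - t - 10 * Real.log t) (g' := fun t => DD t - 1 - 10 * t⁻¹)
    (fun t h => ?_) (fun t h => ?_) ht
  · exact ((XX_hasDeriv t₀ t).sub (hasDerivAt_id t)).sub
      ((Real.hasDerivAt_log (by linarith)).const_mul 10)
  · have := (abs_le.1 (DD_sub_t h)).2
    rw [div_eq_mul_inv] at this
    linarith

lemma XX_low (t₀ : ℝ) {t : ℝ} (ht : 10 ≤ t) :
    t - XX t₀ t - 10 * Real.log t ≤ 10 - XX t₀ 10 - 10 * Real.log 10 := by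
  refine anti_of (g := fun t => t - XX t₀ t - 10 * Real.log t) (g' := fun t => 1 - DD t - 10 * t⁻¹)
    (fun t h => ?_) (fun t h => ?_) ht
  · exact ((hasDerivAt_id t).sub (XX_hasDeriv t₀ t)).sub
      ((Real.hasDerivAt_log (by linarith)).const_mul 10)
  · have := (abs_le.1 (DD_sub_t h)).1
    rw [div_eq_mul_inv] at this
    linarith

lemma XX_div (t₀ : ℝ) : Tendsto (fun t => XX t₀ t / t) atTop (nhds 1) := by
  have hlog : Tendsto (fun t : ℝ => Real.log t / t) atTop (nhds 0) :=
    Real.isLittleO_log_id_atTop.tendsto_div_nhds_zero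
  have hinv : Tendsto (fun t : ℝ => t⁻¹) atTop (nhds 0) := tendsto_inv_atTop_zero
  have hU : Tendsto (fun t : ℝ => 1 + 10 * (Real.log t / t) +
      (XX t₀ 10 - 10 - 10 * Real.log 10) * t⁻¹) atTop (nhds 1) := by
    simpa using (tendsto_const_nhds.add (hlog.const_mul 10)).add (hinv.const_mul _)
  have hL : Tendsto (fun t : ℝ => 1 - 10 * (Real.log t / t) -
      (10 - XX t₀ 10 - 10 * Real.log 10) * t⁻¹) atTop (nhds 1) := by
    simpa using (tendsto_const_nhds.sub (hlog.const_mul 10)).sub (hinv.const_mul _)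
  refine tendsto_of_tendsto_of_tendsto_of_le_of_le' hL hU ?_ ?_
  · filter_upwards [eventually_ge_atTop 10] with t ht
    have := XX_low t₀ ht
    have ht0 : 0 < t := by linarith
    rw [le_div_iff₀ ht0]
    have e : (1 - 10 * (Real.log t / t) - (10 - XX t₀ 10 - 10 * Real.log 10) * t⁻¹) * t
      = t - 10 * Real.log t - (10 - XX t₀ 10 - 10 * Real.log 10) := by field_simp
    linarith
  · filter_upwards [eventually_ge_atTop 10] with t ht
    have := XX_up t₀ ht
    have ht0 : 0 < t := by linarith
    rw [div_le_iff₀ ht0]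
    have e : (1 + 10 * (Real.log t / t) + (XX t₀ 10 - 10 - 10 * Real.log 10) * t⁻¹) * t
      = t + 10 * Real.log t + (XX t₀ 10 - 10 - 10 * Real.log 10) := by field_simp
    linarith

lemma XXhh (t₀ : ℝ) : Tendsto (fun t => XX t₀ t * (π / 2 * hh t)) atTop (nhds (π / 2)) := by
  have hl : Tendsto (fun t : ℝ => (Real.log t)⁻¹) atTop (nhds 0) :=
    tendsto_inv_atTop_zero.comp Real.tendsto_log_atTop
  have := ((XX_div t₀).mul ((hl.const_mul 2).const_add 1)).const_mul (π / 2)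
  simp only [mul_zero, add_zero, mul_one] at this
  refine this.congr' ?_
  filter_upwards [eventually_ge_atTop 10] with t ht
  have := log_ge ht
  unfold hh
  field_simp

lemma XX_strictMono (t₀ : ℝ) : StrictMono (XX t₀) :=
  strictMono_of_hasDerivAt_pos (fun t => XX_hasDeriv t₀ t) (fun t => by linarith [DD_pos t])

lemma XX_self (t₀ : ℝ) : XX t₀ t₀ = 0 := by simp [XX]

lemma XX_sub_mono (t₀ : ℝ) : Monotone (fun t => XX t₀ t - t / 2) := by
  apply monotone_of_deriv_nonneg
  · exact fun t => ((XX_hasDeriv t₀ t).sub ((hasDerivAt_id t).div_const 2)).differentiableAt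
  · intro t
    have : HasDerivAt (fun t => XX t₀ t - t / 2) (DD t - 1 / 2) t :=
      ((XX_hasDeriv t₀ t).sub ((hasDerivAt_id t).div_const 2))
    rw [this.deriv]
    linarith [DD_pos t]

lemma XX_top (t₀ : ℝ) : Tendsto (XX t₀) atTop atTop := by
  refine tendsto_atTop_mono' _ (f₁ := fun t => t / 2 - t₀ / 2) ?_ ?_
  · filter_upwards [eventually_ge_atTop t₀] with t ht
    have := XX_sub_mono t₀ ht
    simp only [XX_self] at this
    linarith
  · exact tendsto_atTop_add_const_right _ _ (tendsto_id.atTop_div_const (by norm_num))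

lemma XX_bot (t₀ : ℝ) : Tendsto (XX t₀) atBot atBot := by
  refine tendsto_atBot_mono' _ (f₁ := fun t => t / 2 - t₀ / 2) ?_ ?_
  · filter_upwards [eventually_le_atBot t₀] with t ht
    have := XX_sub_mono t₀ ht
    simp only [XX_self] at this
    linarith
  · exact tendsto_atBot_add_const_right _ _ (tendsto_id.atBot_div_const (by norm_num))

lemma XX_surj (t₀ : ℝ) : Function.Surjective (XX t₀) :=
  (continuous_iff_continuousAt.2 fun t => (XX_hasDeriv t₀ t).continuousAt).surjective
    (XX_top t₀) (XX_bot t₀)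

def YY (t₀ : ℝ) : ℝ ≃o ℝ := (XX_strictMono t₀).orderIsoOfSurjective _ (XX_surj t₀)

lemma XX_YY (t₀ y : ℝ) : XX t₀ ((YY t₀).symm y) = y := (YY t₀).apply_symm_apply y
lemma YY_XX (t₀ t : ℝ) : (YY t₀).symm (XX t₀ t) = t := (YY t₀).symm_apply_apply t

lemma YY_hasDeriv (t₀ y : ℝ) : HasDerivAt (YY t₀).symm
    (1 - ff ((YY t₀).symm y) * Real.sin ((YY t₀).symm y) ^ 2) y := by
  have := HasDerivAt.of_local_left_inverse (g := (YY t₀).symm) (a := y)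
    (YY t₀).symm.continuous.continuousAt (XX_hasDeriv t₀ _)
    (by linarith [DD_pos ((YY t₀).symm y)]) (Eventually.of_forall (XX_YY t₀))
  simpa [DD] using this

lemma LL_bound (t₀ : ℝ) : ∃ C : ℝ, 0 < C ∧ ∀ t, 10 ≤ t →
    Real.exp (LL t₀ t) ^ 2 ≤ C * (1 / (t * Real.log t ^ 2)) := by
  obtain ⟨M, hM0, hM⟩ := PP_bdd
  let K : ℝ := 29 + 5 * M
  let Ψ : ℝ → ℝ := fun t => LL t₀ t - hh t * PP t + (1 / 2) * (Real.log t + 2 * Real.log (Real.log t))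
    + K * t⁻¹
  have key : ∀ t, 10 ≤ t → Ψ t ≤ Ψ 10 := by
    intro t ht
    refine anti_of (g := Ψ) (g' := fun t => ff t * Real.sin t * Real.cos t * DD t -
      ((-1 / t ^ 2 - 2 * (Real.log t + 1) / (t * Real.log t) ^ 2) * PP t +
        hh t * (1 / 2 - π / 4 * |Real.sin (2 * t)|)) + (1 / 2) * (t⁻¹ + 2 * (t⁻¹ / Real.log t))
        + K * (-(t ^ 2)⁻¹)) (fun t h => ?_) (fun t h => ?_) ht
    · have hl := log_ge h
      have ht0 : t ≠ 0 := by linarith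
      have d := Real.hasDerivAt_log ht0
      exact (((LL_hasDeriv t₀ t).sub ((hh_hasDeriv h).mul (PP_hasDeriv t))).add
        ((d.add ((d.log (by linarith)).const_mul 2)).const_mul (1 / 2))).add
        ((hasDerivAt_inv ht0).const_mul K)
    · have hl := log_ge h
      have ht0 : 0 < t := by linarith
      have e1 : (1 / 2) * (t⁻¹ + 2 * (t⁻¹ / Real.log t)) = hh t / 2 := by
        unfold hh
        field_simp
      simp only [e1]
      set d := (-1 / t ^ 2 - 2 * (Real.log t + 1) / (t * Real.log t) ^ 2)
      have hd : -(d * PP t) ≤ 5 / t ^ 2 * M := by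
        refine le_trans (neg_le_abs _) ?_
        rw [abs_mul]
        exact mul_le_mul (hh_deriv_bd h) (hM t) (abs_nonneg _) (by positivity)
      have hs : ff t * Real.sin t * Real.cos t = ff t * Real.sin (2 * t) / 2 := by
        rw [Real.sin_two_mul]; ring
      have h1 : ff t * Real.sin (2 * t) / 2 ≤ -(π / 4) * hh t * (|Real.sin (2 * t)| - 1 / t) := by
        have a1 := SS_mul t
        have a2 := hh_pos h
        rw [tau_eq h] at a1
        have e : ff t * Real.sin (2 * t) / 2 = -(π / 4 * hh t * (Real.sin (2 * t) * SS t)) := by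
          unfold ff
          rw [tau_eq h]
          ring
        rw [e]
        have : π / 4 * hh t * (|Real.sin (2 * t)| - 1 / t) ≤
          π / 4 * hh t * (Real.sin (2 * t) * SS t) := by gcongr
        linarith
      have h2 : ff t * Real.sin t * Real.cos t * (DD t - 1) ≤ 25 / t ^ 2 := by
        refine le_trans (le_abs_self _) ?_
        rw [hs, abs_mul]
        have b1 : |ff t * Real.sin (2 * t) / 2| ≤ (5 / t) / 2 := by
          rw [abs_div, abs_mul]
          have := Real.abs_sin_le_one (2 * t)
          have := ff_abs_t h
          have := abs_nonneg (ff t)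
          rw [abs_of_pos (by norm_num : (0 : ℝ) < 2)]
          gcongr
          nlinarith
        have := mul_le_mul b1 (DD_sub_t h) (abs_nonneg _) (by positivity)
        refine this.trans (le_of_eq ?_)
        field_simp
        norm_num
      have h3 : π / 4 * hh t * (1 / t) ≤ 3 / t ^ 2 := by
        have a1 := hh_le h
        have a2 := hh_pos h
        have a3 : π / 4 ≤ 1 := by linarith [Real.pi_le_four]
        have : π / 4 * hh t ≤ 1 * (3 / t) := mul_le_mul a3 a1 a2.le (by norm_num)
        have := mul_le_mul_of_nonneg_right this (by positivity : 0 ≤ 1 / t)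
        refine this.trans (le_of_eq ?_)
        field_simp
      have e4 : K * (-(t ^ 2)⁻¹) = -(29 / t ^ 2) - 5 / t ^ 2 * M := by
        simp only [K]; field_simp; ring
      have e5 : (29 : ℝ) / t ^ 2 = 25 / t ^ 2 + 3 / t ^ 2 + 1 / t ^ 2 := by ring
      have e6 : 0 < 1 / t ^ 2 := by positivity
      rw [e4, e5]
      have e7 : ff t * Real.sin t * Real.cos t * DD t =
        ff t * Real.sin t * Real.cos t * (DD t - 1) + ff t * Real.sin (2 * t) / 2 := by
        rw [← hs]; ring
      rw [e7]
      nlinarith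
  refine ⟨Real.exp (2 * (Ψ 10 + M)), Real.exp_pos _, fun t ht => ?_⟩
  have hl := log_ge ht
  have ht0 : 0 < t := by linarith
  have hk := key t ht
  have hPP : hh t * PP t ≤ M := by
    have a1 := hh_pos ht
    have a2 : hh t ≤ 1 := (hh_le ht).trans (by rw [div_le_one ht0]; linarith)
    have a3 := (abs_le.1 (hM t)).2
    nlinarith
  have hK : 0 ≤ K * t⁻¹ := by positivity
  have e : Real.exp (LL t₀ t) ^ 2 = Real.exp (2 * LL t₀ t) := by
    rw [← Real.exp_nat_mul]; norm_num
  have e2 : 1 / (t * Real.log t ^ 2) = Real.exp (-(Real.log t + 2 * Real.log (Real.log t))) := by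
    rw [Real.exp_neg, Real.exp_add, Real.exp_log ht0, two_mul, Real.exp_add, Real.exp_log (by linarith)]
    rw [one_div, pow_two]
  rw [e, e2, ← Real.exp_add]
  apply Real.exp_le_exp.2
  simp only [Ψ] at hk ⊢
  linarith

lemma limsup_part (t₀ k : ℝ) (hk : 0 < k) :
    Filter.limsup (fun x : ℝ => x * |k ^ 2 * ff ((YY t₀).symm (k * x))|) Filter.atTop
      = k * (π / 2) := by
  have hkx : Tendsto (fun x : ℝ => k * x) atTop atTop := tendsto_id.const_mul_atTop hk
  have hφ : Tendsto (fun x : ℝ => (YY t₀).symm (k * x)) atTop atTop :=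
    ((YY t₀).symm.tendsto_atTop).comp hkx
  have hU := ((XXhh t₀).comp hφ).const_mul k
  have hle : ∀ᶠ x : ℝ in atTop, x * |k ^ 2 * ff ((YY t₀).symm (k * x))| ≤
      k * ((fun t => XX t₀ t * (π / 2 * hh t)) ∘ (fun x : ℝ => (YY t₀).symm (k * x))) x := by
    filter_upwards [hφ.eventually_ge_atTop 10, eventually_ge_atTop 0] with x hx hx0
    simp only [Function.comp, XX_YY]
    have := ff_abs_le ((YY t₀).symm (k * x))
    rw [tau_eq hx] at this
    rw [abs_mul, abs_of_pos (by positivity : 0 < k ^ 2)]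
    have h2 : x * k ^ 2 * |ff ((YY t₀).symm (k * x))| ≤ x * k ^ 2 *
      (π / 2 * hh ((YY t₀).symm (k * x))) := by gcongr
    linarith
  have hge : ∀ᶠ x : ℝ in atTop, 0 ≤ x * |k ^ 2 * ff ((YY t₀).symm (k * x))| := by
    filter_upwards [eventually_ge_atTop 0] with x hx0
    positivity
  have hbd : IsBoundedUnder (· ≤ ·) atTop (fun x : ℝ => x * |k ^ 2 * ff ((YY t₀).symm (k * x))|) :=
    hU.isBoundedUnder_le.mono_le hle
  have hcb : IsCoboundedUnder (· ≤ ·) atTop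
      (fun x : ℝ => x * |k ^ 2 * ff ((YY t₀).symm (k * x))|) :=
    IsCoboundedUnder.of_frequently_ge hge.frequently
  apply le_antisymm
  · rw [← hU.limsup_eq]
    exact limsup_le_limsup hle hcb hU.isBoundedUnder_le
  · apply le_of_forall_lt
    intro b hb
    obtain ⟨c, hbc, hc⟩ := exists_between hb
    refine lt_of_lt_of_le hbc (le_limsup_of_frequently_le ?_ hbd)
    let tn : ℕ → ℝ := fun n => π / 4 + n * π
    have htn : Tendsto tn atTop atTop :=
      tendsto_atTop_add_const_left _ _ (tendsto_natCast_atTop_atTop.atTop_mul_const Real.pi_pos)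
    have hxn : Tendsto (fun n => XX t₀ (tn n) / k) atTop atTop :=
      ((XX_top t₀).comp htn).atTop_div_const hk
    refine hxn.frequently (Eventually.frequently ?_)
    have h1 := (((XXhh t₀).comp htn).const_mul k)
    have h2 : Tendsto (fun n => 1 / (1 + 1 / tn n)) atTop (nhds 1) := by
      have : Tendsto (fun n => 1 / tn n) atTop (nhds 0) := by
        simpa [Function.comp_def] using tendsto_inv_atTop_zero.comp htn
      have h5 := (this.const_add 1).inv₀ (by norm_num)
      simpa using h5
    have h3 := h1.mul h2
    rw [mul_one] at h3
    filter_upwards [h3.eventually (lt_mem_nhds hc), htn.eventually_ge_atTop 10] with n hn hn10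
    refine hn.le.trans (le_of_eq ?_)
    have e : k * (XX t₀ (tn n) / k) = XX t₀ (tn n) := by field_simp
    rw [e, YY_XX]
    have hs : |Real.sin (2 * tn n)| = 1 := by
      have : 2 * tn n = π / 2 + n * (2 * π) := by simp only [tn]; ring
      rw [this, Real.sin_add_nat_mul_two_pi, Real.sin_pi_div_two, abs_one]
    have hS : |SS (tn n)| = 1 / (1 + 1 / tn n) := by
      unfold SS
      rw [abs_div, hs, tau_eq hn10, abs_of_pos (by positivity)]
    have hf : |ff (tn n)| = π / 2 * hh (tn n) * (1 / (1 + 1 / tn n)) := by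
      unfold ff
      rw [abs_mul, hS, tau_eq hn10, abs_mul, abs_neg, abs_of_pos (hh_pos hn10),
        abs_of_pos (by positivity : 0 < π / 2)]
    rw [abs_mul, hf, abs_of_pos (by positivity : 0 < k ^ 2)]
    simp only [Function.comp]
    generalize 1 / (1 + 1 / tn n) = q
    field_simp

lemma exists_phase (k θ : ℝ) (hk : 0 < k) : ∃ t₀ : ℝ, 10 ≤ t₀ ∧
    k * Real.cos t₀ * Real.cos θ = Real.sin t₀ * Real.sin θ := by
  let z : ℂ := ⟨Real.sin θ, k * Real.cos θ⟩
  have hz : z ≠ 0 := by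
    intro h
    have h1 : Real.sin θ = 0 := congrArg Complex.re h
    have h2 : k * Real.cos θ = 0 := congrArg Complex.im h
    have h3 : Real.cos θ = 0 := by
      rcases mul_eq_zero.1 h2 with h | h
      · linarith
      · exact h
    have := Real.sin_sq_add_cos_sq θ
    rw [h1, h3] at this
    norm_num at this
  refine ⟨z.arg + (3 : ℕ) * (2 * π), ?_, ?_⟩
  · have := Complex.neg_pi_lt_arg z
    have := Real.pi_gt_three
    push_cast
    linarith
  · rw [Real.cos_add_nat_mul_two_pi, Real.sin_add_nat_mul_two_pi, Complex.cos_arg hz, Complex.sin_arg]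
    simp only [z]
    ring

end

end Crit

open Crit in
/-- Let `a ≠ 0` and `λ = 4a²/π²`. For every `θ ∈ [0,π]` there is a continuous
potential `V` on `[0,∞)` with `limsup_{x→∞} x·|V(x)| = |a|` such that the Schrödinger
equation `-u'' + V·u = λ·u` has a nonzero `L²(ℝ⁺)` solution `u`, twice continuously
differentiable on `[0,∞)`, satisfying `u'(0)·cos θ = u(0)·sin θ`. -/
theorem schrodinger_critical_eigenvalue
    (a : ℝ) (ha : a ≠ 0) (lam : ℝ) (hlam : lam = 4 * a ^ 2 / Real.pi ^ 2)
    (θ : ℝ) (hθ : θ ∈ Set.Icc 0 Real.pi) :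
    ∃ V : ℝ → ℝ, ContinuousOn V (Set.Ici 0) ∧
      Filter.limsup (fun x : ℝ => x * |V x|) Filter.atTop = |a| ∧
      ∃ u : ℝ → ℝ, ContDiffOn ℝ 2 u (Set.Ici 0) ∧
        (∀ x : ℝ, 0 < x → -(deriv (deriv u) x) + V x * u x = lam * u x) ∧
        (∃ x ∈ Set.Ici (0 : ℝ), u x ≠ 0) ∧
        MeasureTheory.IntegrableOn (fun x => (u x) ^ 2) (Set.Ioi 0) ∧
        deriv u 0 * Real.cos θ = u 0 * Real.sin θ := by
  obtain ⟨k, hkdef⟩ : ∃ k : ℝ, k = 2 * |a| / π := ⟨_, rfl⟩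
  have hk : 0 < k := by rw [hkdef]; positivity
  have hlk : lam = k ^ 2 := by
    rw [hlam, hkdef, div_pow, mul_pow, sq_abs]; norm_num
  obtain ⟨t₀, ht₀, hph⟩ := exists_phase k θ hk
  obtain ⟨φ, hφdef⟩ : ∃ φ : ℝ → ℝ, φ = fun x => (YY t₀).symm (k * x) := ⟨_, rfl⟩
  have hφ0 : φ 0 = t₀ := by
    have := YY_XX t₀ t₀
    rw [XX_self] at this
    simp [hφdef, this]
  have hφd : ∀ x, HasDerivAt φ (k * (1 - ff (φ x) * Real.sin (φ x) ^ 2)) x := by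
    intro x
    have h1 := (YY_hasDeriv t₀ (k * x)).comp x ((hasDerivAt_id x).const_mul k)
    rw [hφdef]
    refine HasDerivAt.congr_deriv (f := fun x => (YY t₀).symm (k * x)) h1 ?_
    ring
  have hφc : Continuous φ := continuous_iff_continuousAt.2 fun x => (hφd x).continuousAt
  have hφt : Tendsto φ atTop atTop := by
    rw [hφdef]
    exact ((YY t₀).symm.tendsto_atTop).comp (tendsto_id.const_mul_atTop hk)
  have hφm : ∀ x, 0 ≤ x → 10 ≤ φ x := by
    intro x hx
    refine ht₀.trans ?_
    rw [← hφ0, hφdef]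
    apply (YY t₀).symm.monotone
    simp only [mul_zero]
    positivity
  let u : ℝ → ℝ := fun x => Real.exp (LL t₀ (φ x)) * Real.sin (φ x)
  let v : ℝ → ℝ := fun x => k * (Real.exp (LL t₀ (φ x)) * Real.cos (φ x))
  have hE : ∀ x, HasDerivAt (fun x => Real.exp (LL t₀ (φ x)))
      (Real.exp (LL t₀ (φ x)) * (k * ff (φ x) * Real.sin (φ x) * Real.cos (φ x))) x := by
    intro x
    have h1 := ((LL_hasDeriv t₀ (φ x)).comp x (hφd x)).exp
    refine HasDerivAt.congr_deriv (f := fun x => Real.exp (LL t₀ (φ x))) h1 ?_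
    have : DD (φ x) * (1 - ff (φ x) * Real.sin (φ x) ^ 2) = 1 := by
      unfold DD
      have := (den_bd (φ x)).1
      rw [one_div, inv_mul_cancel₀ (by linarith)]
    simp only [Function.comp]
    linear_combination Real.exp (LL t₀ (φ x)) * (k * ff (φ x) * Real.sin (φ x) * Real.cos (φ x)) * this
  have hu : ∀ x, HasDerivAt u (v x) x := by
    intro x
    refine HasDerivAt.congr_deriv (f := u) ((hE x).mul (hφd x).sin) ?_
    simp only [v]
    ring
  have hv : ∀ x, HasDerivAt v ((k ^ 2 * ff (φ x) - k ^ 2) * u x) x := by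
    intro x
    refine HasDerivAt.congr_deriv (f := v) (((hE x).mul (hφd x).cos).const_mul k) ?_
    simp only [u]
    have := Real.sin_sq_add_cos_sq (φ x)
    linear_combination k ^ 2 * ff (φ x) * Real.exp (LL t₀ (φ x)) * Real.sin (φ x) * this
  have hdu : deriv u = v := funext fun x => (hu x).deriv
  have hdv : deriv v = fun x => (k ^ 2 * ff (φ x) - k ^ 2) * u x := funext fun x => (hv x).deriv
  have huc : Continuous u := continuous_iff_continuousAt.2 fun x => (hu x).continuousAt
  have hVc : Continuous (fun x => k ^ 2 * ff (φ x)) := continuous_const.mul (ff_cont.comp hφc)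
  refine ⟨fun x => k ^ 2 * ff (φ x), hVc.continuousOn, ?_, u, ?_, ?_, ?_, ?_, ?_⟩
  · rw [hφdef, limsup_part t₀ k hk, hkdef]
    field_simp
  · apply ContDiff.contDiffOn
    rw [show (2 : WithTop ℕ∞) = 1 + 1 by norm_num, contDiff_succ_iff_deriv]
    refine ⟨fun x => (hu x).differentiableAt, by simp, ?_⟩
    rw [hdu, contDiff_one_iff_deriv, hdv]
    exact ⟨fun x => (hv x).differentiableAt, (hVc.sub continuous_const).mul huc⟩
  · intro x _
    rw [hdu, hdv, hlk]
    ring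
  · obtain ⟨n, hn⟩ := exists_nat_ge t₀
    refine ⟨XX t₀ (π / 2 + n * (2 * π)) / k, ?_, ?_⟩
    · apply div_nonneg _ hk.le
      rw [← XX_self t₀]
      apply (XX_strictMono t₀).monotone
      have := Real.pi_gt_three
      have : (0 : ℝ) ≤ n := by positivity
      nlinarith
    · have e : φ (XX t₀ (π / 2 + n * (2 * π)) / k) = π / 2 + n * (2 * π) := by
        rw [hφdef]
        simp only
        rw [mul_div_cancel₀ _ hk.ne', YY_XX]
      simp only [u, e]
      rw [Real.sin_add_nat_mul_two_pi, Real.sin_pi_div_two, mul_one]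
      exact (Real.exp_pos _).ne'
  · obtain ⟨C, hC, hCb⟩ := LL_bound t₀
    have hint : IntegrableOn (fun x => k * (1 - ff (φ x) * Real.sin (φ x) ^ 2) *
        (1 / (φ x * Real.log (φ x) ^ 2))) (Ioi 0) := by
      refine integrableOn_Ioi_deriv_of_nonneg' (g := fun x => -(Real.log (φ x))⁻¹) (l := -0) ?_ ?_ ?_
      · intro x hx
        have h10 := hφm x hx
        have hl := log_ge h10
        refine HasDerivAt.congr_deriv (f := fun x => -(Real.log (φ x))⁻¹)
          ((((hφd x).log (by linarith)).inv (by linarith)).neg) ?_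
        field_simp
      · intro x hx
        have h10 := hφm x (le_of_lt hx)
        have := (den_bd (φ x)).1
        have : 0 ≤ 1 - ff (φ x) * Real.sin (φ x) ^ 2 := by linarith
        positivity
      · exact (tendsto_inv_atTop_zero.comp (Real.tendsto_log_atTop.comp hφt)).neg
    refine (hint.const_mul (C * (2 / k))).mono' (huc.pow 2).aestronglyMeasurable ?_
    refine (ae_restrict_iff' measurableSet_Ioi).2 (Eventually.of_forall fun x hx => ?_)
    have h10 := hφm x (le_of_lt hx)
    have hb := hCb _ h10
    have hd := (den_bd (φ x)).1
    rw [Real.norm_of_nonneg (sq_nonneg _)]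
    simp only [u]
    rw [mul_pow]
    have hs := Real.sin_sq_le_one (φ x)
    have hw : 0 ≤ 1 / (φ x * Real.log (φ x) ^ 2) := by positivity
    generalize 1 / (φ x * Real.log (φ x) ^ 2) = w at *
    have e : C * (2 / k) * (k * (1 - ff (φ x) * Real.sin (φ x) ^ 2) * w) =
      C * w * (2 * (1 - ff (φ x) * Real.sin (φ x) ^ 2)) := by field_simp
    rw [e]
    refine (mul_le_of_le_one_right (by positivity) hs).trans (hb.trans ?_)
    apply le_mul_of_one_le_right (by positivity)
    linarith
  · rw [hdu]
    simp only [u, v, hφ0]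
    linear_combination Real.exp (LL t₀ t₀) * hph
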